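/- arXiv:2502.07435 — 7 statements merged into one kernel-verified Lean document; each statement's English description precedes it below -/
import Mathlib

section
/- Let f : ℝⁿ → ℝ be bounded from below by f_low ∈ ℝ, let ε > 0 and C_max > 0, let T ≥ 1 be an integer, let x_0, x_1, …, x_T ∈ ℝⁿ, and let t_0, …, t_{T−1} be nonnegative integers such that f(x_k) − f(x_{k+1}) ≥ (1 + t_k) ε²/(2 C_max) for every k = 0, 1, …, T−1. Define the average S = (1/T) Σ_{k=0}^{T−1} t_k. Then T ≤ 2 C_max (f(x_0) − f_low) / ((1 + S) ε²). -/
/-- Lemma 3: outer-iteration complexity bound. If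
`f (x k) − f (x (k+1)) ≥ (1 + t k) ε² / (2 C_max)` for `k = 0, …, T−1` and `f` is bounded
below by `f_low`, then `T ≤ 2 C_max (f (x 0) − f_low) / ((1 + S) ε²)` where `S` is the
average of the `t k`. -/
theorem outer_iteration_complexity
    {n : ℕ} (f : EuclideanSpace ℝ (Fin n) → ℝ) (f_low : ℝ)
    (hbd : ∀ x, f_low ≤ f x)
    (ε C_max : ℝ) (hε : 0 < ε) (hC : 0 < C_max)
    (T : ℕ) (hT : 1 ≤ T)
    (x : ℕ → EuclideanSpace ℝ (Fin n)) (t : ℕ → ℕ)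
    (hdec : ∀ k < T, f (x k) - f (x (k + 1)) ≥ (1 + (t k : ℝ)) * ε ^ 2 / (2 * C_max))
    (S : ℝ) (hS : S = (∑ k ∈ Finset.range T, (t k : ℝ)) / T) :
    (T : ℝ) ≤ 2 * C_max * (f (x 0) - f_low) / ((1 + S) * ε ^ 2) := by
  have hT' : (0 : ℝ) < T := by exact_mod_cast hT
  have hS0 : 0 ≤ S := hS ▸ by positivity
  have hsum : ∑ k ∈ Finset.range T, (t k : ℝ) = T * S := by
    rw [hS]
    field_simp
  have htotal : T * (1 + S) * ε ^ 2 / (2 * C_max) ≤ f (x 0) - f_low :=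
    calc T * (1 + S) * ε ^ 2 / (2 * C_max)
        = ∑ k ∈ Finset.range T, (1 + (t k : ℝ)) * ε ^ 2 / (2 * C_max) := by
          rw [← Finset.sum_div, ← Finset.sum_mul, Finset.sum_add_distrib, hsum]
          simp [mul_add]
      _ ≤ ∑ k ∈ Finset.range T, (f (x k) - f (x (k + 1))) :=
          Finset.sum_le_sum fun k hk => hdec k (Finset.mem_range.mp hk)
      _ = f (x 0) - f (x T) := Finset.sum_range_sub' (fun k => f (x k)) T
      _ ≤ f (x 0) - f_low := sub_le_sub_left (hbd (x T)) _
  rw [div_le_iff₀ (by positivity)] at htotal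
  rw [le_div_iff₀ (by positivity)]
  linarith
end

section
/- Let n ≥ 1 be an integer, Δ ≥ 0, ε > 0, C_max > 0, and 0 < σ_0 ≤ σ_max. Let T ≥ 1 be an integer, let σ_0, σ_1, …, σ_T be positive reals with σ_{k+1} ≥ 2^{i_k − 1} σ_k for k = 0, …, T−1 and σ_T ≤ σ_max, where i_0, …, i_{T−1} are nonnegative integers, and let t_0, …, t_{T−1} be nonnegative integers with average S = (1/T) Σ_{k=0}^{T−1} t_k. Assume T (1 + S) ≤ 2 C_max Δ ε^{−2}. Then Σ_{k=0}^{T−1} [ (i_k + 1)(n + 1) + (t_k + 1) ] ≤ 4 η(S) (n + 1) C_max Δ ε^{−2} + (n + 1) log₂(σ_max / σ_0) + T, where η(S) = (1 + S/(2(n+1))) / (1 + S). -/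
/-- If `σ (k + 1) ≥ 2 ^ (i k - 1) * σ k` for all `k < T`, then the exponents `i k` sum to at most
`T + log₂ (σ T / σ 0)`. -/
theorem sum_le_add_logb_div_of_zpow_mul_le (T : ℕ) (σ : ℕ → ℝ) (hσpos : ∀ k ≤ T, 0 < σ k)
    (i : ℕ → ℕ) (hupd : ∀ k < T, (2 : ℝ) ^ ((i k : ℤ) - 1) * σ k ≤ σ (k + 1)) :
    ∑ k ∈ Finset.range T, (i k : ℝ) ≤ T + Real.logb 2 (σ T / σ 0) := by
  have step : ∀ k ∈ Finset.range T,
      (i k : ℝ) ≤ 1 + (Real.logb 2 (σ (k + 1)) - Real.logb 2 (σ k)) := by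
    intro k hk
    rw [Finset.mem_range] at hk
    have h0 := hσpos k hk.le
    have h := Real.logb_le_logb_of_le one_lt_two (by positivity) (hupd k hk)
    rw [Real.logb_mul (by positivity) h0.ne', ← Real.rpow_intCast,
      Real.logb_rpow two_pos (by norm_num)] at h
    push_cast at h
    linarith
  rw [Real.logb_div (hσpos T le_rfl).ne' (hσpos 0 T.zero_le).ne']
  calc ∑ k ∈ Finset.range T, (i k : ℝ)
      ≤ ∑ k ∈ Finset.range T, (1 + (Real.logb 2 (σ (k + 1)) - Real.logb 2 (σ k))) :=
        Finset.sum_le_sum step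
    _ = T + (Real.logb 2 (σ T) - Real.logb 2 (σ 0)) := by
        rw [Finset.sum_add_distrib, Finset.sum_range_sub (fun k => Real.logb 2 (σ k))]
        simp

/-- Theorem 1, quantitative content: bound on the total number of function
evaluations `∑_{k<T} ((i k + 1)(n+1) + (t k + 1))` in terms of the surrogate gain
`η(S) = (1 + S/(2(n+1)))/(1 + S)`. -/
theorem function_evaluation_complexity
    (n : ℕ) (hn : 1 ≤ n)
    (Δ ε C_max : ℝ) (hΔ : 0 ≤ Δ) (hε : 0 < ε) (hC : 0 < C_max)
    (σ_max : ℝ)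
    (T : ℕ) (hT : 1 ≤ T)
    (σ : ℕ → ℝ) (hσpos : ∀ k ≤ T, 0 < σ k)
    (hσ0 : 0 < σ 0) (hσ0max : σ 0 ≤ σ_max)
    (i : ℕ → ℕ)
    (hupd : ∀ k < T, (2 : ℝ) ^ ((i k : ℤ) - 1) * σ k ≤ σ (k + 1))
    (hσT : σ T ≤ σ_max)
    (t : ℕ → ℕ)
    (S : ℝ) (hS : S = (∑ k ∈ Finset.range T, (t k : ℝ)) / T)
    (hTS : (T : ℝ) * (1 + S) ≤ 2 * C_max * Δ / ε ^ 2)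
    (η : ℝ) (hη : η = (1 + S / (2 * ((n : ℝ) + 1))) / (1 + S)) :
    (∑ k ∈ Finset.range T, (((i k : ℝ) + 1) * ((n : ℝ) + 1) + ((t k : ℝ) + 1))) ≤
      4 * η * ((n : ℝ) + 1) * C_max * Δ / ε ^ 2 +
        ((n : ℝ) + 1) * Real.logb 2 (σ_max / σ 0) + T := by
  have hT' : (0 : ℝ) < T := by exact_mod_cast hT
  have hS0 : 0 ≤ S := by rw [hS]; positivity
  have ht : ∑ k ∈ Finset.range T, (t k : ℝ) = T * S := by
    rw [hS]; field_simp
  have hlog : Real.logb 2 (σ T / σ 0) ≤ Real.logb 2 (σ_max / σ 0) :=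
    Real.logb_le_logb_of_le one_lt_two (div_pos (hσpos T le_rfl) hσ0) (by gcongr)
  have hi : ∑ k ∈ Finset.range T, (i k : ℝ) ≤ T + Real.logb 2 (σ_max / σ 0) :=
    (sum_le_add_logb_div_of_zpow_mul_le T σ hσpos i hupd).trans (by gcongr)
  have hη0 : 0 ≤ η := by rw [hη]; positivity
  have hgain : T * (2 * ((n : ℝ) + 1) + S) = 2 * η * ((n : ℝ) + 1) * (T * (1 + S)) := by
    rw [hη]; field_simp
  have hbound : 2 * η * ((n : ℝ) + 1) * (T * (1 + S)) ≤
      2 * η * ((n : ℝ) + 1) * (2 * C_max * Δ / ε ^ 2) := by gcongr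
  calc ∑ k ∈ Finset.range T, (((i k : ℝ) + 1) * ((n : ℝ) + 1) + ((t k : ℝ) + 1))
      = ((n : ℝ) + 1) * (∑ k ∈ Finset.range T, (i k : ℝ)) + T * ((n : ℝ) + 1) + T * S + T := by
        simp only [Finset.sum_add_distrib, ← Finset.sum_mul, ht, Finset.sum_const,
          Finset.card_range, nsmul_eq_mul]
        ring
    _ ≤ ((n : ℝ) + 1) * (T + Real.logb 2 (σ_max / σ 0)) + T * ((n : ℝ) + 1) + T * S + T := by
        gcongr
    _ = T * (2 * ((n : ℝ) + 1) + S) + ((n : ℝ) + 1) * Real.logb 2 (σ_max / σ 0) + T := by ring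
    _ ≤ 2 * η * ((n : ℝ) + 1) * (2 * C_max * Δ / ε ^ 2) +
          ((n : ℝ) + 1) * Real.logb 2 (σ_max / σ 0) + T := by
        rw [hgain]; gcongr
    _ = 4 * η * ((n : ℝ) + 1) * C_max * Δ / ε ^ 2 +
          ((n : ℝ) + 1) * Real.logb 2 (σ_max / σ 0) + T := by ring
end

section
/- Let n ≥ 1 be an integer, Δ ≥ 0, ε > 0, C_max > 0, and 0 < σ_0 ≤ σ_max. Let T ≥ 1 be an integer, let σ_0, σ_1, …, σ_T be positive reals with σ_{k+1} ≥ 2^{i_k − 1} σ_k for k = 0, …, T−1 and σ_T ≤ σ_max, where i_0, …, i_{T−1} are nonnegative integers, and let t_0, …, t_{T−1} be nonnegative integers with average S = (1/T) Σ_{k=0}^{T−1} t_k. Assume T (1 + S) ≤ 2 C_max Δ ε^{−2} and S ≥ n. Then Σ_{k=0}^{T−1} [ (i_k + 1)(n + 1) + (t_k + 1) ] ≤ 6 C_max Δ ε^{−2} + (n + 1) log₂(σ_max / σ_0) + T. -/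
/-- If each step multiplies a positive sequence by at least `2 ^ (i k - 1)`, then the exponents
`i k - 1` sum to at most the base-two logarithm of the overall growth. -/
lemma sum_sub_one_le_logb_div {σ : ℕ → ℝ} {i : ℕ → ℕ} {T : ℕ} (hσ : ∀ k ≤ T, 0 < σ k)
    (h : ∀ k < T, (2 : ℝ) ^ ((i k : ℤ) - 1) * σ k ≤ σ (k + 1)) :
    ∑ k ∈ Finset.range T, ((i k : ℝ) - 1) ≤ Real.logb 2 (σ T / σ 0) := by
  rw [Real.logb_div (hσ T le_rfl).ne' (hσ 0 T.zero_le).ne',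
    ← Finset.sum_range_sub (fun k => Real.logb 2 (σ k))]
  refine Finset.sum_le_sum fun k hk => ?_
  have hkT := Finset.mem_range.mp hk
  have hk0 := hσ k hkT.le
  have hlog := Real.logb_le_logb_of_le one_lt_two (by positivity) (h k hkT)
  rw [Real.logb_mul (by positivity) hk0.ne', ← Real.rpow_intCast,
    Real.logb_rpow two_pos one_lt_two.ne'] at hlog
  push_cast at hlog
  linarith

/-- ideal-case corollary of Theorem 1: when the average number of successful
surrogate steps satisfies `S ≥ n`, the total function-evaluation count is bounded by
`6 C_max Δ ε⁻² + (n+1) log₂(σ_max/σ_0) + T`. -/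
theorem function_evaluation_complexity_ideal
    (n : ℕ) (hn : 1 ≤ n)
    (Δ ε C_max : ℝ) (hΔ : 0 ≤ Δ) (hε : 0 < ε) (hC : 0 < C_max)
    (σ_max : ℝ)
    (T : ℕ) (hT : 1 ≤ T)
    (σ : ℕ → ℝ) (hσpos : ∀ k ≤ T, 0 < σ k)
    (hσ0 : 0 < σ 0) (hσ0max : σ 0 ≤ σ_max)
    (i : ℕ → ℕ)
    (hupd : ∀ k < T, (2 : ℝ) ^ ((i k : ℤ) - 1) * σ k ≤ σ (k + 1))
    (hσT : σ T ≤ σ_max)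
    (t : ℕ → ℕ)
    (S : ℝ) (hS : S = (∑ k ∈ Finset.range T, (t k : ℝ)) / T)
    (hTS : (T : ℝ) * (1 + S) ≤ 2 * C_max * Δ / ε ^ 2)
    (hSn : S ≥ (n : ℝ)) :
    (∑ k ∈ Finset.range T, (((i k : ℝ) + 1) * ((n : ℝ) + 1) + ((t k : ℝ) + 1))) ≤
      6 * C_max * Δ / ε ^ 2 + ((n : ℝ) + 1) * Real.logb 2 (σ_max / σ 0) + T := by
  have hT0 : (0 : ℝ) < T := by exact_mod_cast hT
  have hlog : ∑ k ∈ Finset.range T, ((i k : ℝ) - 1) ≤ Real.logb 2 (σ_max / σ 0) := by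
    have hσT0 := hσpos T le_rfl
    refine (sum_sub_one_le_logb_div hσpos hupd).trans
      (Real.logb_le_logb_of_le one_lt_two (by positivity) ?_)
    gcongr
  have hmul := mul_le_mul_of_nonneg_left hlog (by positivity : (0 : ℝ) ≤ (n : ℝ) + 1)
  have ht : ∑ k ∈ Finset.range T, (t k : ℝ) = T * S := by
    rw [hS]
    field_simp
  have hTn : (T : ℝ) * n ≤ T * S := mul_le_mul_of_nonneg_left hSn hT0.le
  have hM : 6 * C_max * Δ / ε ^ 2 = 3 * (2 * C_max * Δ / ε ^ 2) := by ring
  simp only [Finset.sum_sub_distrib, Finset.sum_add_distrib, ← Finset.sum_mul, Finset.sum_const,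
    Finset.card_range, nsmul_eq_mul, mul_one, ht] at hmul ⊢
  rw [hM]
  linarith
end

section
/- Let m : ℝⁿ → ℝ be twice continuously differentiable, let f : ℝⁿ → ℝ, let z ∈ ℝⁿ and h > 0, and suppose the interpolation conditions m(z) = f(z) and m(z + h e_l) = f(z + h e_l) hold for every l = 1, …, n, where e_1, …, e_n is the standard basis of ℝⁿ. Let g_h(z) ∈ ℝⁿ be the forward finite-difference gradient of f at z, defined coordinatewise by [g_h(z)]_l = (f(z + h e_l) − f(z))/h. Then there exist ζ_1, …, ζ_n ∈ [0, 1] such that ‖g_h(z) − ∇m(z)‖₂² = (h²/4) Σ_{l=1}^{n} ( [∇²m(z + h ζ_l e_l)]_{ll} )², where [∇²m(x)]_{ll} denotes the second partial derivative of m in the l-th coordinate direction at x. -/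
/-- Second-order Taylor formula along a segment, with Lagrange remainder. -/
theorem exists_sub_sub_fderiv_eq_iteratedFDeriv_two {E : Type*} [NormedAddCommGroup E]
    [NormedSpace ℝ E] {m : E → ℝ} (hm : ContDiff ℝ 2 m) (z v : E) :
    ∃ t ∈ Set.Ioo (0 : ℝ) 1,
      m (z + v) - m z - fderiv ℝ m z v = iteratedFDeriv ℝ 2 m (z + t • v) ![v, v] / 2 := by
  have hline (t : ℝ) : HasDerivAt (fun s : ℝ => z + s • v) v t := by
    simpa using ((hasDerivAt_id t).smul_const v).const_add z
  have hφ (t : ℝ) : HasDerivAt (fun s : ℝ => m (z + s • v)) (fderiv ℝ m (z + t • v) v) t :=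
    ((hm.differentiable (by norm_num)) _).hasFDerivAt.comp_hasDerivAt t (hline t)
  have hφ' (t : ℝ) : HasDerivAt (fun s : ℝ => fderiv ℝ m (z + s • v) v)
      (fderiv ℝ (fderiv ℝ m) (z + t • v) v v) t := by
    have hd : Differentiable ℝ (fderiv ℝ m) :=
      (hm.fderiv_right (m := 1) (by norm_num)).differentiable (by norm_num)
    simpa using ((hd _).hasFDerivAt.comp_hasDerivAt t (hline t)).clm_apply (hasDerivAt_const t v)
  have ha (t : ℝ) : HasDerivAt
      (fun s : ℝ => m (z + s • v) + (1 - s) * fderiv ℝ m (z + s • v) v)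
      ((1 - t) * fderiv ℝ (fderiv ℝ m) (z + t • v) v v) t := by
    exact ((hφ t).add (((hasDerivAt_id t).const_sub 1).mul (hφ' t))).congr_deriv (by simp)
  have hb (t : ℝ) : HasDerivAt (fun s : ℝ => (1 - s) ^ 2) (-2 * (1 - t)) t := by
    exact (((hasDerivAt_id t).const_sub 1).pow 2).congr_deriv (by simp)
  obtain ⟨t, ht, hab⟩ := exists_ratio_hasDerivAt_eq_ratio_slope _ _ zero_lt_one
    (fun t _ => (ha t).continuousAt.continuousWithinAt) (fun t _ => ha t)
    _ _ (fun t _ => (hb t).continuousAt.continuousWithinAt) (fun t _ => hb t)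
  refine ⟨t, ht, ?_⟩
  have h1t : 1 - t ≠ 0 := (sub_pos.2 ht.2).ne'
  rw [iteratedFDeriv_two_apply]
  simp only [one_smul, zero_smul, add_zero, sub_self, sub_zero, Matrix.cons_val_zero,
    Matrix.cons_val_one] at hab ⊢
  apply mul_left_cancel₀ h1t
  linear_combination hab / 2

/-- Proposition 1: if the twice continuously differentiable surrogate `m`
interpolates `f` at `z` and at `z + h e_l` for every `l`, then the squared error between the
forward finite-difference gradient `g_h(z)` of `f` and `∇m(z)` equals
`(h²/4) ∑_l ([∇²m(z + h ζ_l e_l)]_{ll})²` for some `ζ_l ∈ [0,1]`. -/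
theorem sobolev_learning_curvature_penalty
    {n : ℕ} (m f : EuclideanSpace ℝ (Fin n) → ℝ)
    (hm : ContDiff ℝ 2 m)
    (z : EuclideanSpace ℝ (Fin n)) (h : ℝ) (hh : 0 < h)
    (hinterp0 : m z = f z)
    (hinterp : ∀ l : Fin n,
      m (z + h • EuclideanSpace.single l (1 : ℝ)) = f (z + h • EuclideanSpace.single l (1 : ℝ)))
    (g : EuclideanSpace ℝ (Fin n))
    (hg : ∀ l : Fin n,
      g l = (f (z + h • EuclideanSpace.single l (1 : ℝ)) - f z) / h) :
    ∃ ζ : Fin n → ℝ, (∀ l, ζ l ∈ Set.Icc (0 : ℝ) 1) ∧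
      ‖g - gradient m z‖ ^ 2 =
        h ^ 2 / 4 * ∑ l : Fin n,
          (iteratedFDeriv ℝ 2 m (z + (h * ζ l) • EuclideanSpace.single l (1 : ℝ))
            ![EuclideanSpace.single l (1 : ℝ), EuclideanSpace.single l (1 : ℝ)]) ^ 2 := by
  have taylor (l : Fin n) := exists_sub_sub_fderiv_eq_iteratedFDeriv_two hm z
    (h • EuclideanSpace.single l (1 : ℝ))
  choose ζ hζ hrem using taylor
  refine ⟨ζ, fun l => Set.Ioo_subset_Icc_self (hζ l), ?_⟩
  rw [EuclideanSpace.norm_sq_eq, Finset.mul_sum]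
  refine Finset.sum_congr rfl fun l _ => ?_
  have hgrad : gradient m z l = fderiv ℝ m z (EuclideanSpace.single l 1) := by
    rw [← inner_gradient_left, EuclideanSpace.inner_single_right]
    simp
  have hcoord : g l - gradient m z l =
      h / 2 * iteratedFDeriv ℝ 2 m (z + (h * ζ l) • EuclideanSpace.single l (1 : ℝ))
        ![EuclideanSpace.single l (1 : ℝ), EuclideanSpace.single l (1 : ℝ)] := by
    have hr := hrem l
    rw [hinterp l, hinterp0, smul_smul, mul_comm (ζ l) h, iteratedFDeriv_two_apply] at hr
    simp only [Matrix.cons_val_zero, Matrix.cons_val_one, map_smul,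
      smul_apply, smul_eq_mul] at hr
    rw [hg l, hgrad, iteratedFDeriv_two_apply]
    simp only [Matrix.cons_val_zero, Matrix.cons_val_one]
    field_simp
    linear_combination 2 * hr
  rw [PiLp.sub_apply, Real.norm_eq_abs, sq_abs, hcoord]
  ring
end

section
/- Let f : ℝⁿ → ℝ be differentiable with L-Lipschitz continuous gradient, i.e., ‖∇f(x) − ∇f(y)‖₂ ≤ L ‖x − y‖₂ for all x, y ∈ ℝⁿ. Let x ∈ ℝⁿ and h > 0, and let g_h(x) ∈ ℝⁿ be the forward finite-difference gradient of f at x, defined coordinatewise by [g_h(x)]_l = (f(x + h e_l) − f(x))/h, where e_1, …, e_n is the standard basis of ℝⁿ. Then ‖g_h(x) − ∇f(x)‖₂ ≤ (√n · L · h)/2. -/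
/-- The first-order Taylor remainder of a function with `L`-Lipschitz gradient is at most
`L / 2 * ‖v‖ ^ 2`. -/
theorem abs_sub_sub_inner_gradient_le {E : Type*} [NormedAddCommGroup E] [InnerProductSpace ℝ E]
    [CompleteSpace E] {f : E → ℝ} (hf : Differentiable ℝ f) {L : ℝ}
    (hlip : ∀ x y : E, ‖gradient f x - gradient f y‖ ≤ L * ‖x - y‖) (x v : E) :
    |f (x + v) - f x - inner ℝ (gradient f x) v| ≤ L / 2 * ‖v‖ ^ 2 := by
  have hderiv (t : ℝ) : HasDerivAt
      (fun t : ℝ => f (x + t • v) - f x - t * inner ℝ (gradient f x) v)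
      (inner ℝ (gradient f (x + t • v) - gradient f x) v) t := by
    have hline : HasDerivAt (fun t : ℝ => x + t • v) v t := by
      simpa using ((hasDerivAt_id t).smul_const v).const_add x
    have hcomp := (hf (x + t • v)).hasGradientAt.hasFDerivAt.comp_hasDerivAt t hline
    have hlin := (hasDerivAt_id t).mul_const (inner ℝ (gradient f x) v)
    rw [inner_sub_left]
    exact ((hcomp.sub_const (f x)).sub hlin).congr_deriv (by simp)
  have hbound (t : ℝ) : HasDerivAt (fun t : ℝ => L / 2 * ‖v‖ ^ 2 * t ^ 2)
      (L * ‖v‖ ^ 2 * t) t :=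
    ((hasDerivAt_pow 2 t).const_mul (L / 2 * ‖v‖ ^ 2)).congr_deriv (by norm_num; ring)
  have key := image_norm_le_of_norm_deriv_right_le_deriv_boundary (a := 0) (b := 1)
    (fun t _ => (hderiv t).continuousAt.continuousWithinAt)
    (fun t _ => (hderiv t).hasDerivWithinAt) (by simp) hbound
    (fun t ht => by
      calc ‖inner ℝ (gradient f (x + t • v) - gradient f x) v‖
          ≤ ‖gradient f (x + t • v) - gradient f x‖ * ‖v‖ := norm_inner_le_norm _ _
        _ ≤ L * ‖x + t • v - x‖ * ‖v‖ := by gcongr; exact hlip _ _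
        _ = L * ‖v‖ ^ 2 * t := by
          rw [add_sub_cancel_left, norm_smul, Real.norm_of_nonneg ht.1]; ring)
    (Set.right_mem_Icc.2 zero_le_one)
  simpa using key

/-- The Euclidean norm is at most `√n` times any bound on the coordinates. -/
theorem EuclideanSpace.norm_le_sqrt_mul_of_abs_le {n : ℕ} {y : EuclideanSpace ℝ (Fin n)} {c : ℝ}
    (hy : ∀ i, |y i| ≤ c) : ‖y‖ ≤ √n * c := by
  rcases n.eq_zero_or_pos with rfl | hn
  · simp [Subsingleton.elim y 0]
  have hc : 0 ≤ c := (abs_nonneg _).trans (hy ⟨0, hn⟩)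
  rw [EuclideanSpace.norm_eq, ← Real.sqrt_sq hc, ← Real.sqrt_mul n.cast_nonneg]
  refine Real.sqrt_le_sqrt ?_
  calc ∑ i, ‖y i‖ ^ 2 ≤ ∑ _i : Fin n, c ^ 2 := by
        gcongr with i
        exact hy i
    _ = n * c ^ 2 := by simp


/-- forward finite-difference gradient error bound. If `∇f` is `L`-Lipschitz,
then `‖g_h(x) − ∇f(x)‖₂ ≤ √n L h / 2`. -/
theorem finite_difference_error_bound
    {n : ℕ} (f : EuclideanSpace ℝ (Fin n) → ℝ) (hf : Differentiable ℝ f)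
    (L : ℝ)
    (hlip : ∀ x y : EuclideanSpace ℝ (Fin n),
      ‖gradient f x - gradient f y‖ ≤ L * ‖x - y‖)
    (x : EuclideanSpace ℝ (Fin n)) (h : ℝ) (hh : 0 < h)
    (g : EuclideanSpace ℝ (Fin n))
    (hg : ∀ l : Fin n,
      g l = (f (x + h • EuclideanSpace.single l (1 : ℝ)) - f x) / h) :
    ‖g - gradient f x‖ ≤ Real.sqrt n * L * h / 2 := by
  have hcoord (l : Fin n) : |(g - gradient f x) l| ≤ L * h / 2 := by
    have key := abs_sub_sub_inner_gradient_le hf hlip x (h • EuclideanSpace.single l (1 : ℝ))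
    simp only [inner_smul_right, EuclideanSpace.inner_single_right, norm_smul,
      PiLp.norm_single, Real.norm_of_nonneg hh.le, norm_one, mul_one, one_mul,
      conj_trivial] at key
    have heq : (g - gradient f x) l =
        (f (x + h • EuclideanSpace.single l (1 : ℝ)) - f x - h * gradient f x l) / h := by
      rw [PiLp.sub_apply, hg]
      field_simp
    rw [heq, abs_div, abs_of_pos hh, div_le_iff₀ hh]
    linarith
  calc ‖g - gradient f x‖ ≤ √n * (L * h / 2) :=
        EuclideanSpace.norm_le_sqrt_mul_of_abs_le hcoord
    _ = √n * L * h / 2 := by ring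
end

section
/- Let f : ℝⁿ → ℝ be differentiable with L-Lipschitz continuous gradient, let ε > 0 and σ ≥ L, and set h = 2ε / (5 √n σ). Then the forward finite-difference gradient g_h(x), defined coordinatewise by [g_h(x)]_l = (f(x + h e_l) − f(x))/h, satisfies ‖g_h(x) − ∇f(x)‖₂ ≤ ε/5 for every x ∈ ℝⁿ. -/
/-- A Euclidean vector whose coordinates are at most `c` in absolute value has norm at most
`√n * c`. -/
theorem EuclideanSpace.norm_le_sqrt_mul_of_abs_le_s11 {n : ℕ} {v : EuclideanSpace ℝ (Fin n)} {c : ℝ}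
    (hc : 0 ≤ c) (hv : ∀ l, |v l| ≤ c) : ‖v‖ ≤ √n * c := by
  rw [EuclideanSpace.norm_eq, ← Real.sqrt_sq hc, ← Real.sqrt_mul (Nat.cast_nonneg n)]
  refine Real.sqrt_le_sqrt ?_
  calc ∑ l, ‖v l‖ ^ 2 ≤ ∑ _l : Fin n, c ^ 2 := by
        gcongr with l
        exact hv l
    _ = n * c ^ 2 := by simp

/-- with the stepsize `h = 2ε/(5 √n σ)` and `σ ≥ L`, the forward
finite-difference gradient satisfies `‖g_h(x) − ∇f(x)‖₂ ≤ ε/5` for every `x`. -/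
theorem finite_difference_accuracy
    {n : ℕ} (f : EuclideanSpace ℝ (Fin n) → ℝ) (hf : Differentiable ℝ f)
    (L : ℝ)
    (hlip : ∀ x y : EuclideanSpace ℝ (Fin n),
      ‖gradient f x - gradient f y‖ ≤ L * ‖x - y‖)
    (ε σ : ℝ) (hε : 0 < ε) (hσpos : 0 < σ) (hσ : σ ≥ L)
    (h : ℝ) (hh : h = 2 * ε / (5 * Real.sqrt n * σ)) :
    ∀ x : EuclideanSpace ℝ (Fin n), ∀ g : EuclideanSpace ℝ (Fin n),
      (∀ l : Fin n,
        g l = (f (x + h • EuclideanSpace.single l (1 : ℝ)) - f x) / h) →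
      ‖g - gradient f x‖ ≤ ε / 5 := by
  intro x g hg
  rcases Nat.eq_zero_or_pos n with rfl | hn
  · rw [Subsingleton.elim (g - gradient f x) 0, norm_zero]
    positivity
  have hsqrt : 0 < √(n : ℝ) := Real.sqrt_pos.2 (Nat.cast_pos.2 hn)
  have hpos : 0 < h := by rw [hh]; positivity
  have hcoord : ∀ l, |(g - gradient f x) l| ≤ σ * h / 2 := by
    intro l
    have hT := abs_sub_sub_inner_gradient_le hf hlip x (h • EuclideanSpace.single l (1 : ℝ))
    have hnorm : ‖h • EuclideanSpace.single l (1 : ℝ)‖ = h := by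
      simp [norm_smul, abs_of_pos hpos]
    have hinner : inner ℝ (gradient f x) (h • EuclideanSpace.single l (1 : ℝ))
        = h * gradient f x l := by
      rw [real_inner_smul_right, EuclideanSpace.inner_single_right]
      simp
    rw [hnorm, hinner] at hT
    have hsplit : (g - gradient f x) l
        = (f (x + h • EuclideanSpace.single l (1 : ℝ)) - f x - h * gradient f x l) / h := by
      rw [PiLp.sub_apply, hg l]
      field_simp
    rw [hsplit, abs_div, abs_of_pos hpos, div_le_iff₀ hpos]
    calc _ ≤ L / 2 * h ^ 2 := hT
      _ ≤ σ / 2 * h ^ 2 := by gcongr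
      _ = σ * h / 2 * h := by ring
  calc ‖g - gradient f x‖ ≤ √n * (σ * h / 2) :=
        EuclideanSpace.norm_le_sqrt_mul_of_abs_le_s11 (by positivity) hcoord
    _ = ε / 5 := by
      rw [hh]
      field_simp
end

section
/- Let f : ℝⁿ → ℝ be differentiable with L-Lipschitz continuous gradient, let ε > 0, let x ∈ ℝⁿ and g ∈ ℝⁿ satisfy ‖g − ∇f(x)‖₂ ≤ ε/5 and ‖g‖₂ ≥ 4ε/5, and let σ ≥ L. Then f(x) − f(x − (1/σ) g) ≥ ‖g‖₂² / (8σ). -/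
/-- The descent lemma: a function with `L`-Lipschitz gradient lies below its quadratic upper
model. -/
theorem le_add_inner_gradient_add_sq {E : Type*} [NormedAddCommGroup E] [InnerProductSpace ℝ E]
    [CompleteSpace E] {f : E → ℝ} (hf : Differentiable ℝ f) {L : ℝ}
    (hlip : ∀ x y, ‖gradient f x - gradient f y‖ ≤ L * ‖x - y‖) (x v : E) :
    f (x + v) ≤ f x + inner ℝ (gradient f x) v + L / 2 * ‖v‖ ^ 2 := by
  have hφ (t : ℝ) : HasDerivAt (fun t : ℝ => f (x + t • v))
      (inner ℝ (gradient f (x + t • v)) v) t := by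
    have hline : HasDerivAt (fun t : ℝ => x + t • v) v t := by
      simpa using ((hasDerivAt_id t).smul_const v).const_add x
    have h := (hf (x + t • v)).hasGradientAt.hasFDerivAt.comp_hasDerivAt t hline
    rwa [InnerProductSpace.toDual_apply_apply] at h
  have hB (t : ℝ) : HasDerivAt
      (fun t : ℝ => f x + t * inner ℝ (gradient f x) v + L / 2 * ‖v‖ ^ 2 * t ^ 2)
      (inner ℝ (gradient f x) v + L * ‖v‖ ^ 2 * t) t := by
    have h := (((hasDerivAt_id t).mul_const (inner ℝ (gradient f x) v)).const_add (f x)).add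
      ((hasDerivAt_pow 2 t).const_mul (L / 2 * ‖v‖ ^ 2))
    refine h.congr_deriv ?_
    norm_num
    ring
  have hle := image_le_of_deriv_right_le_deriv_boundary (a := 0) (b := 1)
    (fun t _ => (hφ t).continuousAt.continuousWithinAt)
    (fun t _ => (hφ t).hasDerivWithinAt) (by simp)
    (fun t _ => (hB t).continuousAt.continuousWithinAt)
    (fun t _ => (hB t).hasDerivWithinAt) (fun t ht => ?_)
    (Set.right_mem_Icc.2 zero_le_one)
  · simpa using hle
  · have h1 := real_inner_le_norm (gradient f (x + t • v) - gradient f x) v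
    have h2 := mul_le_mul_of_nonneg_right (hlip (x + t • v) x) (norm_nonneg v)
    rw [add_sub_cancel_left, norm_smul, Real.norm_of_nonneg ht.1] at h2
    rw [inner_sub_left] at h1
    linarith

/-- sufficient decrease with an approximate gradient. If
`‖g − ∇f(x)‖ ≤ ε/5`, `‖g‖ ≥ 4ε/5` and `σ ≥ L`, then
`f(x) − f(x − g/σ) ≥ ‖g‖²/(8σ)`. -/
theorem sufficient_decrease_approx_gradient
    {n : ℕ} (f : EuclideanSpace ℝ (Fin n) → ℝ) (hf : Differentiable ℝ f)
    (L : ℝ)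
    (hlip : ∀ x y : EuclideanSpace ℝ (Fin n),
      ‖gradient f x - gradient f y‖ ≤ L * ‖x - y‖)
    (ε : ℝ) (hε : 0 < ε)
    (x g : EuclideanSpace ℝ (Fin n))
    (hgerr : ‖g - gradient f x‖ ≤ ε / 5)
    (hgnorm : ‖g‖ ≥ 4 * ε / 5)
    (σ : ℝ) (hσ : σ ≥ L) :
    f x - f (x - (1 / σ) • g) ≥ ‖g‖ ^ 2 / (8 * σ) := by
  have hg : 0 < ‖g‖ := by linarith
  have hL : 0 ≤ L := by
    have h := (norm_nonneg _).trans (hlip g 0)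
    rw [sub_zero] at h
    exact nonneg_of_mul_nonneg_left h hg
  rcases (hL.trans hσ).eq_or_lt with rfl | hσ0
  · simp
  have hdesc := le_add_inner_gradient_add_sq hf hlip x (-((1 / σ) • g))
  rw [← sub_eq_add_neg, inner_neg_right, inner_smul_right, norm_neg, norm_smul,
    Real.norm_of_nonneg (by positivity)] at hdesc
  have hinner : 3 / 4 * ‖g‖ ^ 2 ≤ inner ℝ (gradient f x) g := by
    have h := real_inner_le_norm (g - gradient f x) g
    rw [inner_sub_left, real_inner_self_eq_norm_sq] at h
    nlinarith
  have hlinear := mul_le_mul_of_nonneg_left hinner (show 0 ≤ 1 / σ by positivity)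
  have hquad : L / 2 * (1 / σ * ‖g‖) ^ 2 ≤ 1 / σ * (‖g‖ ^ 2 / 2) :=
    calc L / 2 * (1 / σ * ‖g‖) ^ 2 ≤ σ / 2 * (1 / σ * ‖g‖) ^ 2 := by gcongr
      _ = 1 / σ * (‖g‖ ^ 2 / 2) := by field_simp
  have hrhs : ‖g‖ ^ 2 / (8 * σ) = 1 / σ * ‖g‖ ^ 2 / 8 := by field_simp
  have hpos : 0 ≤ 1 / σ * ‖g‖ ^ 2 := by positivity
  rw [hrhs]
  linarith
end
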